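/- Suppose L₁ and L₂ are skew lines in H. Then there is a hyperbola Y ⊂ ℝ² with asymptotes π(L₁) and π(L₂) (i.e. Y is the image of {(u,v) ∈ ℝ² : uv = C} for some C ≠ 0 under the affine map taking the coordinate axes to π(L₁) and π(L₂)) such that: every straight line in ℝ² tangent to Y has a unique horizontal lift to a line of H which intersects both L₁ and L₂; and conversely, if L is a line of H with L ∩ L₁ ≠ ∅ and L ∩ L₂ ≠ ∅, then π(L) is tangent to Y. -/

import Mathlib

open MeasureTheory Set Topology Filter

noncomputable section

/-- The Heisenberg group as a set: `ℝ³`. -/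
abbrev Heis : Type := ℝ × ℝ × ℝ

/-- The Heisenberg group multiplication
`(a,b,c)·(a',b',c') = (a+a', b+b', c+c'+a·b')`. -/
def hMul (x y : Heis) : Heis :=
  (x.1 + y.1, x.2.1 + y.2.1, x.2.2 + y.2.2 + x.1 * y.2.1)

/-- The abelianization homomorphism `π : H → ℝ²`, `π(a,b,c) = (a,b)`. -/
def hPi (x : Heis) : ℝ × ℝ := (x.1, x.2.1)

/-- The (horizontal) line of the Heisenberg group through `g` with direction `(a,b)`:
`{g·(ta, tb, t²ab/2) : t ∈ ℝ}`. -/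
def hLine (g : Heis) (a b : ℝ) : Set Heis :=
  {p | ∃ t : ℝ, p = hMul g (t * a, t * b, t ^ 2 * a * b / 2)}

/-- A subset of the Heisenberg group is a (horizontal) line. -/
def IsLine (L : Set Heis) : Prop :=
  ∃ g : Heis, ∃ a b : ℝ, ¬(a = 0 ∧ b = 0) ∧ L = hLine g a b

/-- Two lines of `H` are parallel if their `π`-images are parallel straight lines
in `ℝ²`, i.e. their direction vectors are linearly dependent. -/
def AreParallelLines (L₁ L₂ : Set Heis) : Prop :=
  ∃ g₁ g₂ : Heis, ∃ a₁ b₁ a₂ b₂ : ℝ,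
    ¬(a₁ = 0 ∧ b₁ = 0) ∧ ¬(a₂ = 0 ∧ b₂ = 0) ∧
    L₁ = hLine g₁ a₁ b₁ ∧ L₂ = hLine g₂ a₂ b₂ ∧ a₁ * b₂ = a₂ * b₁

/-- Two lines of `H` are skew if they are disjoint and not parallel. -/
def AreSkewLines (L₁ L₂ : Set Heis) : Prop :=
  IsLine L₁ ∧ IsLine L₂ ∧ Disjoint L₁ L₂ ∧ ¬ AreParallelLines L₁ L₂

theorem mem_hLine_iff {g q : Heis} {a b : ℝ} :
    q ∈ hLine g a b ↔ ∃ t : ℝ, q.1 = g.1 + t * a ∧ q.2.1 = g.2.1 + t * b ∧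
      q.2.2 = g.2.2 + t ^ 2 * a * b / 2 + g.1 * (t * b) := by
  simp [hLine, hMul, Prod.ext_iff]

theorem self_mem_hLine (g : Heis) (a b : ℝ) : g ∈ hLine g a b :=
  mem_hLine_iff.2 ⟨0, by simp⟩

theorem hLine_eq_of_mem {g p : Heis} {a b : ℝ} (hp : p ∈ hLine g a b) :
    hLine g a b = hLine p a b := by
  obtain ⟨t, h1, h2, h3⟩ := mem_hLine_iff.1 hp
  ext q
  simp only [mem_hLine_iff, h1, h2, h3]
  constructor
  · rintro ⟨s, k1, k2, k3⟩
    exact ⟨s - t, by rw [k1]; ring, by rw [k2]; ring, by rw [k3]; ring⟩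
  · rintro ⟨s, k1, k2, k3⟩
    exact ⟨s + t, by rw [k1]; ring, by rw [k2]; ring, by rw [k3]; ring⟩

theorem hLine_smul (g : Heis) (a b : ℝ) {k : ℝ} (hk : k ≠ 0) :
    hLine g (k * a) (k * b) = hLine g a b := by
  ext q
  simp only [mem_hLine_iff]
  constructor
  · rintro ⟨s, k1, k2, k3⟩
    exact ⟨s * k, by rw [k1]; ring, by rw [k2]; ring, by rw [k3]; ring⟩
  · rintro ⟨s, k1, k2, k3⟩
    exact ⟨s / k, by rw [k1]; field_simp, by rw [k2]; field_simp, by rw [k3]; field_simp⟩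

theorem hPi_image_hLine (g : Heis) (a b : ℝ) :
    hPi '' hLine g a b = {q | ∃ t : ℝ, q = hPi g + t • (a, b)} := by
  ext q
  constructor
  · rintro ⟨r, ⟨t, rfl⟩, rfl⟩
    exact ⟨t, by simp [hPi, hMul]⟩
  · rintro ⟨t, rfl⟩
    exact ⟨_, ⟨t, rfl⟩, by simp [hPi, hMul]⟩

/-- Two points on a common horizontal line satisfy the integrated contact relation. -/
theorem IsLine.contact {L : Set Heis} (hL : IsLine L) {p q : Heis} (hp : p ∈ L) (hq : q ∈ L) :
    2 * (q.2.2 - p.2.2) = (q.2.1 - p.2.1) * (q.1 + p.1) := by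
  obtain ⟨g, a, b, -, rfl⟩ := hL
  rw [hLine_eq_of_mem hp] at hq
  obtain ⟨t, h1, h2, h3⟩ := mem_hLine_iff.1 hq
  rw [h1, h2, h3]
  ring

theorem mem_hLine_of_contact {p q : Heis}
    (h : 2 * (q.2.2 - p.2.2) = (q.2.1 - p.2.1) * (q.1 + p.1)) :
    q ∈ hLine p (q.1 - p.1) (q.2.1 - p.2.1) :=
  mem_hLine_iff.2 ⟨1, by ring, by ring, by linear_combination h / 2⟩

theorem IsLine.eq_hLine {L : Set Heis} (hL : IsLine L) {p q : Heis} (hp : p ∈ L) (hq : q ∈ L)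
    (hpq : p ≠ q) : L = hLine p (q.1 - p.1) (q.2.1 - p.2.1) := by
  obtain ⟨g, a, b, -, rfl⟩ := hL
  rw [hLine_eq_of_mem hp] at hq ⊢
  obtain ⟨t, h1, h2, h3⟩ := mem_hLine_iff.1 hq
  have ht : t ≠ 0 := by
    rintro rfl
    exact hpq (by ext <;> simp_all)
  rw [← hLine_smul p a b ht, h1, h2]
  congr 1 <;> ring

/-- The line joining the axis points `p + s • e₁` and `p + r • e₂` is tangent to the
hyperbola `u * v = C` in the frame `(p, e₁, e₂)` when `s * r = 4 * C`. -/
theorem secant_eq_tangent (p e₁ e₂ : ℝ × ℝ) (C : ℝ) {u : ℝ} (hu : u ≠ 0) :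
    {q : ℝ × ℝ | ∃ t : ℝ, q = (p + (2 * u) • e₁) +
        t • ((p + (2 * C / u) • e₂) - (p + (2 * u) • e₁))} =
      {q | ∃ t : ℝ, q = (p + u • e₁ + (C / u) • e₂) + t • (e₁ - (C / u ^ 2) • e₂)} := by
  ext q
  constructor
  · rintro ⟨t, rfl⟩
    refine ⟨u - 2 * u * t, ?_⟩
    ext <;> simp <;> field_simp <;> ring
  · rintro ⟨t, rfl⟩
    refine ⟨(u - t) / (2 * u), ?_⟩
    ext <;> simp <;> field_simp <;> ring

theorem eq_of_frame_eq {p e₁ e₂ : ℝ × ℝ} (hD : e₁.1 * e₂.2 - e₁.2 * e₂.1 ≠ 0)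
    {u v u' v' : ℝ} (h : p + u • e₁ + v • e₂ = p + u' • e₁ + v' • e₂) : u = u' ∧ v = v' := by
  have h1 := congrArg Prod.fst h
  have h2 := congrArg Prod.snd h
  simp only [Prod.fst_add, Prod.snd_add, Prod.smul_fst, Prod.smul_snd, smul_eq_mul] at h1 h2
  constructor
  · apply mul_right_cancel₀ hD
    linear_combination e₂.2 * h1 - e₂.1 * h2
  · apply mul_right_cancel₀ hD
    linear_combination e₁.1 * h2 - e₁.2 * h1

/-- Two nonparallel lines have points over the intersection of their projections. -/
theorem exists_hPi_eq (g₁ g₂ : Heis) {a₁ b₁ a₂ b₂ : ℝ} (hD : a₁ * b₂ - b₁ * a₂ ≠ 0) :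
    ∃ p₁ ∈ hLine g₁ a₁ b₁, ∃ p₂ ∈ hLine g₂ a₂ b₂, hPi p₁ = hPi p₂ := by
  refine ⟨_, ⟨((g₂.1 - g₁.1) * b₂ - (g₂.2.1 - g₁.2.1) * a₂) / (a₁ * b₂ - b₁ * a₂), rfl⟩,
    _, ⟨((g₂.1 - g₁.1) * b₁ - (g₂.2.1 - g₁.2.1) * a₁) / (a₁ * b₂ - b₁ * a₂), rfl⟩, ?_⟩
  simp only [hPi, hMul, Prod.mk.injEq]
  generalize hd : a₁ * b₂ - b₁ * a₂ = d at hD ⊢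
  constructor <;> field_simp <;> rw [← hd] <;> ring

/-- The point at parameter `t` of the horizontal line through `g` with direction `e`. -/
def hPoint (g : Heis) (e : ℝ × ℝ) (t : ℝ) : Heis :=
  hMul g (t * e.1, t * e.2, t ^ 2 * e.1 * e.2 / 2)

theorem hPi_hPoint (g : Heis) (e : ℝ × ℝ) (t : ℝ) : hPi (hPoint g e t) = hPi g + t • e := by
  ext <;> simp [hPi, hPoint, hMul]

/-- Points on two lines meeting over a common base point satisfy the contact relation exactly when
the product of their parameters is a fixed constant. -/
theorem contact_hPoint_iff {p₁ p₂ : Heis} (hp : hPi p₁ = hPi p₂) {e₁ e₂ : ℝ × ℝ}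
    (hD : e₁.1 * e₂.2 - e₁.2 * e₂.1 ≠ 0) (s r : ℝ) :
    2 * ((hPoint p₂ e₂ r).2.2 - (hPoint p₁ e₁ s).2.2) =
        ((hPoint p₂ e₂ r).2.1 - (hPoint p₁ e₁ s).2.1) *
          ((hPoint p₂ e₂ r).1 + (hPoint p₁ e₁ s).1) ↔
      s * r = 4 * ((p₂.2.2 - p₁.2.2) / (2 * (e₁.1 * e₂.2 - e₁.2 * e₂.1))) := by
  obtain ⟨x, y, z₁⟩ := p₁
  obtain ⟨x', y', z₂⟩ := p₂
  obtain ⟨rfl, rfl⟩ : x = x' ∧ y = y' := by simpa [hPi] using hp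
  simp only [hPoint, hMul]
  have h4 : 4 * ((z₂ - z₁) / (2 * (e₁.1 * e₂.2 - e₁.2 * e₂.1))) =
      2 * (z₂ - z₁) / (e₁.1 * e₂.2 - e₁.2 * e₂.1) := by
    field_simp
    ring
  rw [h4, eq_div_iff hD]
  constructor <;> intro h <;> linear_combination -h

/-- If `L₁, L₂` are skew lines of `H`, there is a hyperbola `Y ⊂ ℝ²` with asymptotes
`π(L₁), π(L₂)` such that every tangent line of `Y` has a unique horizontal lift meeting
both `L₁` and `L₂`, and conversely the projection of any line meeting both `L₁` and
`L₂` is tangent to `Y`.  Here the hyperbola is the image of `{uv = C}` under the affine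
map `(u,v) ↦ p + u•e₁ + v•e₂` taking the coordinate axes to `π(L₁)` and `π(L₂)`, and
its tangent line at parameter `u` is `{p + u•e₁ + (C/u)•e₂ + t•(e₁ - (C/u²)•e₂)}`. -/
theorem statement5 (L₁ L₂ : Set Heis) (hskew : AreSkewLines L₁ L₂) :
    ∃ (p e₁ e₂ : ℝ × ℝ) (C : ℝ), C ≠ 0 ∧
      e₁.1 * e₂.2 - e₁.2 * e₂.1 ≠ 0 ∧
      hPi '' L₁ = {q | ∃ t : ℝ, q = p + t • e₁} ∧
      hPi '' L₂ = {q | ∃ t : ℝ, q = p + t • e₂} ∧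
      (∀ u : ℝ, u ≠ 0 →
        ∃! L : Set Heis, IsLine L ∧
          hPi '' L = {q | ∃ t : ℝ,
            q = (p + u • e₁ + (C / u) • e₂) + t • (e₁ - (C / u ^ 2) • e₂)} ∧
          (L ∩ L₁).Nonempty ∧ (L ∩ L₂).Nonempty) ∧
      (∀ L : Set Heis, IsLine L → (L ∩ L₁).Nonempty → (L ∩ L₂).Nonempty →
        ∃ u : ℝ, u ≠ 0 ∧
          hPi '' L = {q | ∃ t : ℝ,
            q = (p + u • e₁ + (C / u) • e₂) + t • (e₁ - (C / u ^ 2) • e₂)}) := by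
  obtain ⟨⟨g₁, a₁, b₁, hd₁, rfl⟩, ⟨g₂, a₂, b₂, hd₂, rfl⟩, hdisj, hpar⟩ := hskew
  have hD : a₁ * b₂ - b₁ * a₂ ≠ 0 := fun h =>
    hpar ⟨g₁, g₂, a₁, b₁, a₂, b₂, hd₁, hd₂, rfl, rfl, by linarith⟩
  obtain ⟨p₁, hp₁, p₂, hp₂, hp⟩ := exists_hPi_eq g₁ g₂ hD
  rw [hLine_eq_of_mem hp₁, hLine_eq_of_mem hp₂] at hdisj ⊢
  have hz : p₂.2.2 - p₁.2.2 ≠ 0 := by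
    intro h
    refine Set.disjoint_left.1 hdisj (self_mem_hLine _ _ _) ?_
    have h12 : p₁.1 = p₂.1 ∧ p₁.2.1 = p₂.2.1 := by simpa [hPi] using hp
    rw [show p₁ = p₂ from Prod.ext h12.1 (Prod.ext h12.2 (by linarith))]
    exact self_mem_hLine _ _ _
  set e₁ : ℝ × ℝ := (a₁, b₁)
  set e₂ : ℝ × ℝ := (a₂, b₂)
  replace hD : e₁.1 * e₂.2 - e₁.2 * e₂.1 ≠ 0 := hD
  have hcon := contact_hPoint_iff hp hD
  set C : ℝ := (p₂.2.2 - p₁.2.2) / (2 * (e₁.1 * e₂.2 - e₁.2 * e₂.1))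
  have hC : C ≠ 0 := div_ne_zero hz (mul_ne_zero two_ne_zero hD)
  have hne : ∀ s r, hPoint p₁ e₁ s ≠ hPoint p₂ e₂ r := fun s r =>
    hdisj.ne_of_mem ⟨s, rfl⟩ ⟨r, rfl⟩
  have htan : ∀ u : ℝ, u ≠ 0 →
      hPi '' hLine (hPoint p₁ e₁ (2 * u))
        ((hPoint p₂ e₂ (2 * C / u)).1 - (hPoint p₁ e₁ (2 * u)).1)
        ((hPoint p₂ e₂ (2 * C / u)).2.1 - (hPoint p₁ e₁ (2 * u)).2.1) =
      {q | ∃ t : ℝ, q = (hPi p₁ + u • e₁ + (C / u) • e₂) + t • (e₁ - (C / u ^ 2) • e₂)} := by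
    intro u hu
    rw [hPi_image_hLine, ← secant_eq_tangent _ _ _ _ hu, ← hPi_hPoint, hp, ← hPi_hPoint]
    rfl
  refine ⟨hPi p₁, e₁, e₂, C, hC, hD, hPi_image_hLine _ _ _, hp ▸ hPi_image_hLine _ _ _, ?_, ?_⟩
  · intro u hu
    have hmem := mem_hLine_of_contact ((hcon (2 * u) (2 * C / u)).2 (by field_simp; ring))
    refine ⟨_, ⟨⟨_, _, _, ?_, rfl⟩, htan u hu, ⟨_, self_mem_hLine _ _ _, ⟨2 * u, rfl⟩⟩,
      ⟨_, hmem, ⟨2 * C / u, rfl⟩⟩⟩, ?_⟩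
    · rintro ⟨h1, h2⟩
      rw [h1, h2] at hmem
      obtain ⟨t, k1, k2, k3⟩ := mem_hLine_iff.1 hmem
      exact hne (2 * u) (2 * C / u) (by ext <;> simp_all)
    · rintro L ⟨hL, hproj, ⟨_, hAL, ⟨s, rfl⟩⟩, ⟨_, hBL, ⟨r, rfl⟩⟩⟩
      change hPoint p₁ e₁ s ∈ L at hAL
      change hPoint p₂ e₂ r ∈ L at hBL
      have hA := hproj ▸ Set.mem_image_of_mem hPi hAL
      have hB := hproj ▸ Set.mem_image_of_mem hPi hBL
      obtain ⟨t, ht⟩ := hA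
      obtain ⟨t', ht'⟩ := hB
      rw [hPi_hPoint] at ht ht'
      have hs := eq_of_frame_eq (p := hPi p₁) (u := s) (v := 0) (u' := u + t)
        (v' := C / u - t * (C / u ^ 2)) hD (by rw [zero_smul, add_zero, ht]; module)
      have hr := eq_of_frame_eq (p := hPi p₁) (u := 0) (v := r) (u' := u + t')
        (v' := C / u - t' * (C / u ^ 2)) hD (by rw [zero_smul, add_zero, hp, ht', hp]; module)
      obtain rfl : s = 2 * u := by
        have h := hs.2
        field_simp at h
        rw [zero_mul] at h
        linarith [hs.1, (mul_eq_zero.1 h.symm).resolve_left hC]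
      obtain rfl : r = 2 * C / u := by
        rw [hr.2, show t' = -u by linarith [hr.1]]
        field_simp
        ring
      exact hL.eq_hLine hAL hBL (hne _ _)
  · rintro L hL ⟨_, hAL, ⟨s, rfl⟩⟩ ⟨_, hBL, ⟨r, rfl⟩⟩
    change hPoint p₁ e₁ s ∈ L at hAL
    change hPoint p₂ e₂ r ∈ L at hBL
    have hsr := (hcon s r).1 (hL.contact hAL hBL)
    have hs : s ≠ 0 := by
      rintro rfl
      rw [zero_mul] at hsr
      exact hC (by linarith)
    refine ⟨s / 2, by positivity, ?_⟩
    rw [← htan (s / 2) (by positivity), show 2 * (s / 2) = s by ring,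
      show 2 * C / (s / 2) = r by field_simp; linarith, ← hL.eq_hLine hAL hBL (hne _ _)]
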